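/- Let Ax ⊆ {em, t□, str}, where em := p∨¬p, t□ := (⊤⇛p)→p, str := (p→q)→(p⇛q). Then HLC♭⊕Ax has the finite model property: every finite consecution Γ ⇒ φ with Γ ⊬_Ax φ is refuted by some finite flat model whose underlying frame validates every formula of Ax. -/

import Mathlib

/-- Formulas of the language `L⇛`. -/
inductive Fml : Type where
  | var : Nat → Fml
  | top : Fml
  | bot : Fml
  | and : Fml → Fml → Fml
  | or  : Fml → Fml → Fml
  | imp : Fml → Fml → Fml
  | sto : Fml → Fml → Fml
deriving DecidableEq

/-- Uniform substitution. -/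
def Fml.subst (σ : Nat → Fml) : Fml → Fml
  | .var p => σ p
  | .top => .top
  | .bot => .bot
  | .and φ ψ => .and (φ.subst σ) (ψ.subst σ)
  | .or φ ψ => .or (φ.subst σ) (ψ.subst σ)
  | .imp φ ψ => .imp (φ.subst σ) (ψ.subst σ)
  | .sto φ ψ => .sto (φ.subst σ) (ψ.subst σ)

/-- Conjunction `φ₁ ∧ ⋯ ∧ φₙ` of a list of formulas (`⊤` for the empty list). -/
def Fml.conj : List Fml → Fml
  | [] => .top
  | [φ] => φ
  | φ :: ψ :: rest => .and φ (Fml.conj (ψ :: rest))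

/-- Disjunction `φ₁ ∨ ⋯ ∨ φₙ` of a list of formulas (`⊥` for the empty list). -/
def Fml.disj : List Fml → Fml
  | [] => .bot
  | [φ] => φ
  | φ :: ψ :: rest => .or φ (Fml.disj (ψ :: rest))

/-- Axiom schemes of intuitionistic propositional logic (a standard Hilbert-style
axiomatisation); as schemes, they comprise all substitution instances. -/
inductive IpcAx : Fml → Prop where
  | k (φ ψ : Fml) : IpcAx (.imp φ (.imp ψ φ))
  | s (φ ψ χ : Fml) : IpcAx (.imp (.imp φ (.imp ψ χ)) (.imp (.imp φ ψ) (.imp φ χ)))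
  | andE1 (φ ψ : Fml) : IpcAx (.imp (.and φ ψ) φ)
  | andE2 (φ ψ : Fml) : IpcAx (.imp (.and φ ψ) ψ)
  | andI (φ ψ : Fml) : IpcAx (.imp φ (.imp ψ (.and φ ψ)))
  | orI1 (φ ψ : Fml) : IpcAx (.imp φ (.or φ ψ))
  | orI2 (φ ψ : Fml) : IpcAx (.imp ψ (.or φ ψ))
  | orE (φ ψ χ : Fml) : IpcAx (.imp (.imp φ χ) (.imp (.imp ψ χ) (.imp (.or φ ψ) χ)))
  | botE (φ : Fml) : IpcAx (.imp .bot φ)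
  | top : IpcAx .top

/-- Substitution instances of the axioms of intuitionistic logic together with
`k_a : ((p⇛q)∧(p⇛r))→(p⇛(q∧r))` and `tr : ((p⇛q)∧(q⇛r))→(p⇛r)`. -/
inductive BaseAx : Fml → Prop where
  | ipc {φ : Fml} : IpcAx φ → BaseAx φ
  | ka (φ ψ χ : Fml) : BaseAx (.imp (.and (.sto φ ψ) (.sto φ χ)) (.sto φ (.and ψ χ)))
  | tr (φ ψ χ : Fml) : BaseAx (.imp (.and (.sto φ ψ) (.sto ψ χ)) (.sto φ χ))

/-- Derivability of the consecution `Γ ⇒ φ` in `HLC♭ ⊕ Ax`, i.e. `Γ ⊢_Ax φ`. -/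
inductive Deriv (Ax : Set Fml) : Set Fml → Fml → Prop where
  | base {Γ : Set Fml} {φ : Fml} : BaseAx φ → Deriv Ax Γ φ
  | axm {Γ : Set Fml} {ψ : Fml} (σ : Nat → Fml) : ψ ∈ Ax → Deriv Ax Γ (ψ.subst σ)
  | el {Γ : Set Fml} {φ : Fml} : φ ∈ Γ → Deriv Ax Γ φ
  | mp {Γ : Set Fml} {φ ψ : Fml} : Deriv Ax Γ φ → Deriv Ax Γ (.imp φ ψ) → Deriv Ax Γ ψ
  | na {Γ : Set Fml} {φ ψ : Fml} : Deriv Ax (∅ : Set Fml) (.imp φ ψ) → Deriv Ax Γ (.sto φ ψ)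

/-- A flat frame: a nonempty set of worlds with a preorder `≼` and a relation `R`. -/
structure FlatFrame : Type 1 where
  W : Type
  ne : Nonempty W
  le : W → W → Prop
  le_refl : ∀ w, le w w
  le_trans : ∀ ⦃w v u⦄, le w v → le v u → le w u
  R : W → W → Prop

/-- A valuation is admissible if every proposition letter denotes an upset. -/
def FlatFrame.IsUpset (F : FlatFrame) (V : Nat → F.W → Prop) : Prop :=
  ∀ p ⦃w v⦄, F.le w v → V p w → V p v

/-- Truth of a formula at a world of a flat model: the usual intuitionistic Kripke
clauses over `≼`, and `w ⊨ φ⇛ψ` iff for every `w' ≽ w`, `R[w'] ⊆ ⟦φ⟧` implies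
`R[w'] ⊆ ⟦ψ⟧`. -/
def FlatFrame.sat (F : FlatFrame) (V : Nat → F.W → Prop) : Fml → F.W → Prop
  | .var p, w => V p w
  | .top, _ => True
  | .bot, _ => False
  | .and φ ψ, w => F.sat V φ w ∧ F.sat V ψ w
  | .or φ ψ, w => F.sat V φ w ∨ F.sat V ψ w
  | .imp φ ψ, w => ∀ v, F.le w v → F.sat V φ v → F.sat V ψ v
  | .sto φ ψ, w => ∀ w', F.le w w' →
      (∀ v, F.R w' v → F.sat V φ v) → ∀ v, F.R w' v → F.sat V ψ v

/-- A flat frame validates the consecution `Γ ⇒ φ` if in every model on it, every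
world satisfying all formulas of `Γ` satisfies `φ`. -/
def FlatFrame.ValidCons (F : FlatFrame) (Γ : Set Fml) (φ : Fml) : Prop :=
  ∀ V, F.IsUpset V → ∀ w, (∀ ψ ∈ Γ, F.sat V ψ w) → F.sat V φ w

/-- A flat frame validates a formula if it is true at every world in every model on it. -/
def FlatFrame.ValidFml (F : FlatFrame) (φ : Fml) : Prop :=
  ∀ V, F.IsUpset V → ∀ w, F.sat V φ w

/-- `em := p ∨ ¬p` (where `¬φ` abbreviates `φ→⊥`). -/
def emFml : Fml := .or (.var 0) (.imp (.var 0) .bot)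
/-- `t□ := (⊤⇛p)→p`. -/
def tbFml : Fml := .imp (.sto .top (.var 0)) (.var 0)
/-- `str := (p→q)→(p⇛q)`. -/
def strFml : Fml := .imp (.imp (.var 0) (.var 1)) (.sto (.var 0) (.var 1))
/-- `p_a := (p⇛q)→(⊤⇛(p⇛q))`. -/
def paFml : Fml := .imp (.sto (.var 0) (.var 1)) (.sto .top (.sto (.var 0) (.var 1)))
/-- `4a := p⇛(⊤⇛p)`. -/
def fourAFml : Fml := .sto (.var 0) (.sto .top (.var 0))
/-- `di := ((p⇛r)∧(q⇛r))→((p∨q)⇛r)`. -/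
def diFml : Fml := .imp (.and (.sto (.var 0) (.var 2)) (.sto (.var 1) (.var 2)))
    (.sto (.or (.var 0) (.var 1)) (.var 2))

/-- The set of subformulas of a formula. -/
def Fml.sub : Fml → Set Fml
  | .var p => {.var p}
  | .top => {.top}
  | .bot => {.bot}
  | .and φ ψ => insert (.and φ ψ) (φ.sub ∪ ψ.sub)
  | .or φ ψ => insert (.or φ ψ) (φ.sub ∪ ψ.sub)
  | .imp φ ψ => insert (.imp φ ψ) (φ.sub ∪ ψ.sub)
  | .sto φ ψ => insert (.sto φ ψ) (φ.sub ∪ ψ.sub)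

theorem Fml.mem_sub_self (φ : Fml) : φ ∈ φ.sub := by
  cases φ <;> simp [Fml.sub]

theorem Fml.sub_finite (φ : Fml) : φ.sub.Finite := by
  induction φ with
  | var | top | bot => exact Set.finite_singleton _
  | and _ _ h₁ h₂ | or _ _ h₁ h₂ | imp _ _ h₁ h₂ | sto _ _ h₁ h₂ => exact (h₁.union h₂).insert _

namespace Deriv

variable {Ax : Set Fml} {Γ Δ : Set Fml} {φ ψ χ : Fml}

theorem ipc (h : IpcAx φ) : Deriv Ax Γ φ := .base (.ipc h)

theorem mono (h : Deriv Ax Γ φ) (hs : Γ ⊆ Δ) : Deriv Ax Δ φ := by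
  induction h with
  | base h => exact .base h
  | axm σ h => exact .axm σ h
  | el h => exact .el (hs h)
  | mp _ _ h₁ h₂ => exact .mp (h₁ hs) (h₂ hs)
  | na h => exact .na h

theorem imp_of (h : Deriv Ax Γ ψ) : Deriv Ax Γ (.imp φ ψ) := .mp h (ipc (.k ψ φ))

theorem imp_self : Deriv Ax Γ (.imp φ φ) :=
  .mp (ipc (.k φ φ)) (.mp (ipc (.k φ (.imp φ φ))) (ipc (.s φ (.imp φ φ) φ)))

theorem deduction (h : Deriv Ax (insert φ Γ) ψ) : Deriv Ax Γ (.imp φ ψ) := by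
  generalize hΔ : insert φ Γ = Δ at h
  induction h with
  | base h => exact imp_of (.base h)
  | axm σ h => exact imp_of (.axm σ h)
  | el h =>
    subst hΔ
    rcases h with rfl | h
    · exact imp_self
    · exact imp_of (.el h)
  | mp _ _ h₁ h₂ => exact .mp (h₁ hΔ) (.mp (h₂ hΔ) (ipc (.s _ _ _)))
  | na h => exact imp_of (.na h)

theorem and_intro (h₁ : Deriv Ax Γ φ) (h₂ : Deriv Ax Γ ψ) : Deriv Ax Γ (.and φ ψ) :=
  .mp h₂ (.mp h₁ (ipc (.andI φ ψ)))

theorem sto_trans (h₁ : Deriv Ax Γ (.sto φ ψ)) (h₂ : Deriv Ax Γ (.sto ψ χ)) :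
    Deriv Ax Γ (.sto φ χ) :=
  .mp (and_intro h₁ h₂) (.base (.tr _ _ _))

theorem sto_of (h : Deriv Ax ∅ ψ) : Deriv Ax Γ (.sto φ ψ) := .na (imp_of h)

theorem sto_mp (h₁ : Deriv Ax Γ (.sto φ ψ)) (h₂ : Deriv Ax Γ (.sto φ (.imp ψ χ))) :
    Deriv Ax Γ (.sto φ χ) := by
  refine sto_trans (.mp (and_intro h₁ h₂) (.base (.ka _ _ _))) (.na (deduction ?_))
  have h : Deriv Ax (insert (.and ψ (.imp ψ χ)) ∅) (.and ψ (.imp ψ χ)) :=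
    .el (Set.mem_insert _ _)
  exact .mp (.mp h (ipc (.andE1 _ _))) (.mp h (ipc (.andE2 _ _)))

/-- The formulas strictly implied by a fixed formula form a theory. -/
theorem sto_of_deriv (h : Deriv Ax {α | Deriv Ax Γ (.sto φ α)} ψ) : Deriv Ax Γ (.sto φ ψ) := by
  generalize hT : {α | Deriv Ax Γ (.sto φ α)} = T at h
  induction h with
  | base h => exact sto_of (.base h)
  | axm σ h => exact sto_of (.axm σ h)
  | el h => subst hT; exact h
  | mp _ _ h₁ h₂ => exact sto_mp (h₁ hT) (h₂ hT)
  | na h => exact sto_of (.na h)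

theorem exists_of_sUnion {c : Set (Set Fml)} (hc : IsChain (· ⊆ ·) c) (hne : c.Nonempty)
    (h : Deriv Ax (⋃₀ c) φ) : ∃ s ∈ c, Deriv Ax s φ := by
  generalize hΔ : ⋃₀ c = Δ at h
  induction h with
  | base h => exact hne.imp fun _ hs => ⟨hs, .base h⟩
  | axm σ h => exact hne.imp fun _ hs => ⟨hs, .axm σ h⟩
  | el h =>
    subst hΔ
    obtain ⟨s, hs, h⟩ := h
    exact ⟨s, hs, .el h⟩
  | mp _ _ h₁ h₂ =>
    obtain ⟨s, hs, h₁⟩ := h₁ hΔ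
    obtain ⟨t, ht, h₂⟩ := h₂ hΔ
    rcases hc.total hs ht with hst | hts
    · exact ⟨t, ht, .mp (h₁.mono hst) h₂⟩
    · exact ⟨s, hs, .mp h₁ (h₂.mono hts)⟩
  | na h => exact hne.imp fun _ hs => ⟨hs, .na h⟩

end Deriv

/-- Prime theories: consistent, deductively closed sets with the disjunction property. -/
structure PrimeTheory (Ax Γ : Set Fml) : Prop where
  closed : ∀ {φ}, Deriv Ax Γ φ → φ ∈ Γ
  bot_notMem : Fml.bot ∉ Γ
  prime : ∀ {φ ψ}, Fml.or φ ψ ∈ Γ → φ ∈ Γ ∨ ψ ∈ Γ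

theorem exists_primeTheory {Ax Γ : Set Fml} {χ : Fml} (h : ¬ Deriv Ax Γ χ) :
    ∃ Δ, PrimeTheory Ax Δ ∧ Γ ⊆ Δ ∧ χ ∉ Δ := by
  obtain ⟨Δ, hΓ, hmax⟩ := zorn_subset_nonempty {Δ | ¬ Deriv Ax Δ χ}
    (fun c hcs hc hne => ⟨⋃₀ c, fun hd => by
      obtain ⟨s, hs, hd⟩ := hd.exists_of_sUnion hc hne
      exact hcs hs hd, fun _ => Set.subset_sUnion_of_mem⟩) Γ h
  have hχ : ¬ Deriv Ax Δ χ := hmax.prop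
  have key : ∀ {φ}, φ ∉ Δ → Deriv Ax Δ (.imp φ χ) := fun {φ} hφ => by
    by_contra hn
    exact hφ (hmax.le_of_ge (y := insert φ Δ) (fun hd => hn hd.deduction)
      (Set.subset_insert _ _) (Set.mem_insert _ _))
  refine ⟨Δ, ⟨fun hd => ?_, fun hb => ?_, fun hor => ?_⟩, hΓ, fun hm => hχ (.el hm)⟩
  · by_contra hn
    exact hχ (hd.mp (key hn))
  · exact hχ (.mp (.el hb) (.ipc (.botE χ)))
  · by_contra! hn
    exact hχ (.mp (.el hor) (.mp (key hn.2) (.mp (key hn.1) (.ipc (.orE _ _ _)))))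

namespace PrimeTheory

variable {Ax Γ Δ : Set Fml} {φ ψ : Fml}

theorem mp (hΓ : PrimeTheory Ax Γ) (h₁ : φ ∈ Γ) (h₂ : Fml.imp φ ψ ∈ Γ) : ψ ∈ Γ :=
  hΓ.closed (.mp (.el h₁) (.el h₂))

theorem and_mem (hΓ : PrimeTheory Ax Γ) : Fml.and φ ψ ∈ Γ ↔ φ ∈ Γ ∧ ψ ∈ Γ :=
  ⟨fun h => ⟨hΓ.mp h (hΓ.closed (.ipc (.andE1 _ _))), hΓ.mp h (hΓ.closed (.ipc (.andE2 _ _)))⟩,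
    fun h => hΓ.closed (.and_intro (.el h.1) (.el h.2))⟩

theorem or_mem (hΓ : PrimeTheory Ax Γ) : Fml.or φ ψ ∈ Γ ↔ φ ∈ Γ ∨ ψ ∈ Γ :=
  ⟨hΓ.prime, fun h => h.elim (fun h => hΓ.mp h (hΓ.closed (.ipc (.orI1 _ _))))
    (fun h => hΓ.mp h (hΓ.closed (.ipc (.orI2 _ _))))⟩

theorem eq_of_subset (hem : emFml ∈ Ax) (hΓ : PrimeTheory Ax Γ) (hΔ : PrimeTheory Ax Δ)
    (h : Γ ⊆ Δ) : Γ = Δ := by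
  refine h.antisymm fun α hα => ?_
  have : Fml.or α (.imp α .bot) ∈ Γ := hΓ.closed (.axm (fun _ => α) hem)
  rcases hΓ.prime this with h' | h'
  · exact h'
  · exact absurd (hΔ.mp hα (h h')) hΔ.bot_notMem

theorem sto_mem_of_forall (hΓ : PrimeTheory Ax Γ)
    (h : ∀ Δ, PrimeTheory Ax Δ → {α | Fml.sto φ α ∈ Γ} ⊆ Δ → ψ ∈ Δ) : Fml.sto φ ψ ∈ Γ := by
  have hT : {α | Deriv Ax Γ (.sto φ α)} = {α | Fml.sto φ α ∈ Γ} :=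
    Set.ext fun _ => ⟨fun h => hΓ.closed h, fun h => .el h⟩
  refine hΓ.closed (.sto_of_deriv ?_)
  rw [hT]
  by_contra hn
  obtain ⟨Δ, hΔ, hs, hψ⟩ := exists_primeTheory hn
  exact hψ (h Δ hΔ hs)

end PrimeTheory

/-- The order on prime theories restricted to a finite set of formulas: inclusion, sharpened to
equality in the presence of excluded middle. -/
def TraceLE (Ax X Y : Set Fml) : Prop := X ⊆ Y ∧ (emFml ∈ Ax → X = Y)

theorem TraceLE.refl (Ax X : Set Fml) : TraceLE Ax X X := ⟨subset_rfl, fun _ => rfl⟩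

theorem TraceLE.trans {Ax X Y Z : Set Fml} (h₁ : TraceLE Ax X Y) (h₂ : TraceLE Ax Y Z) :
    TraceLE Ax X Z :=
  ⟨h₁.1.trans h₂.1, fun h => (h₁.2 h).trans (h₂.2 h)⟩

theorem PrimeTheory.traceLE {Ax Γ Δ : Set Fml} (S : Set Fml) (hΓ : PrimeTheory Ax Γ)
    (hΔ : PrimeTheory Ax Δ) (h : Γ ⊆ Δ) : TraceLE Ax (Γ ∩ S) (Δ ∩ S) :=
  ⟨Set.inter_subset_inter_left _ h, fun hem => by rw [hΓ.eq_of_subset hem hΔ h]⟩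

/-- The restrictions to `S` of prime theories. -/
def traces (Ax S : Set Fml) : Set (Set Fml) := {X | ∃ Γ, PrimeTheory Ax Γ ∧ X = Γ ∩ S}

/-- A segment over `S`: the restriction of a prime theory to `S`, together with a set of such
restrictions, the intended successors, which respects the strict implications of the former. -/
structure IsSegment (Ax S X : Set Fml) (U : Set (Set Fml)) : Prop where
  head_mem : X ∈ traces Ax S
  tail_subset : U ⊆ traces Ax S
  sto : ∀ {α β}, Fml.sto α β ∈ X → β ∈ S → (∀ Y ∈ U, α ∈ Y) → ∀ Y ∈ U, β ∈ Y
  str : strFml ∈ Ax → ∀ Y ∈ U, TraceLE Ax X Y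

/-- The restrictions to `S` of the prime theories containing everything that `φ` strictly implies
according to `Γ`. -/
def stoTail (Ax S Γ : Set Fml) (φ : Fml) : Set (Set Fml) :=
  {Y | ∃ Δ, PrimeTheory Ax Δ ∧ {α | Fml.sto φ α ∈ Γ} ⊆ Δ ∧ Y = Δ ∩ S}

section Segments

variable {Ax S X Γ : Set Fml}

theorem isSegment_empty (hX : X ∈ traces Ax S) : IsSegment Ax S X ∅ where
  head_mem := hX
  tail_subset := Set.empty_subset _
  sto _ _ _ := by simp
  str _ := by simp

theorem sto_mem_of_stoTail {φ α : Fml} (hΓ : PrimeTheory Ax Γ)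
    (h : ∀ Y ∈ stoTail Ax S Γ φ, α ∈ Y) : Fml.sto φ α ∈ Γ :=
  hΓ.sto_mem_of_forall fun Δ hΔ hs => (h _ ⟨Δ, hΔ, hs, rfl⟩).1

theorem isSegment_stoTail (hΓ : PrimeTheory Ax Γ) (φ : Fml) :
    IsSegment Ax S (Γ ∩ S) (stoTail Ax S Γ φ) where
  head_mem := ⟨Γ, hΓ, rfl⟩
  tail_subset := by
    rintro _ ⟨Δ, hΔ, -, rfl⟩
    exact ⟨Δ, hΔ, rfl⟩
  sto := by
    rintro α β hαβ hβ hα _ ⟨Δ, hΔ, hs, rfl⟩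
    exact ⟨hs (hΓ.closed (.sto_trans (.el (sto_mem_of_stoTail hΓ hα)) (.el hαβ.1))), hβ⟩
  str := by
    rintro hstr _ ⟨Δ, hΔ, hs, rfl⟩
    refine hΓ.traceLE S hΔ fun α hα => hs (hΓ.closed ?_)
    exact .mp (.imp_of (.el hα)) (.axm (fun n => if n = 0 then φ else α) hstr)

/-- The frame of segments over `S`. -/
def segmentFrame (Ax S : Set Fml) (hne : (traces Ax S).Nonempty) : FlatFrame where
  W := {p : Set Fml × Set (Set Fml) // IsSegment Ax S p.1 p.2}
  ne := hne.elim fun X hX => ⟨⟨(X, ∅), isSegment_empty hX⟩⟩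
  le w v := TraceLE Ax w.1.1 v.1.1
  le_refl _ := .refl _ _
  le_trans _ _ _ := .trans
  R w v := v.1.1 ∈ w.1.2

/-- The canonical valuation on the frame of segments. -/
def segmentVal (hne : (traces Ax S).Nonempty) (p : Nat) (w : (segmentFrame Ax S hne).W) : Prop :=
  Fml.var p ∈ w.1.1

variable (hne : (traces Ax S).Nonempty)

theorem segmentFrame_finite (hS : S.Finite) : Finite (segmentFrame Ax S hne).W := by
  have ht : (traces Ax S).Finite := hS.finite_subsets.subset <| by
    rintro _ ⟨Γ, -, rfl⟩
    exact Set.inter_subset_right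
  exact ((ht.prod ht.finite_subsets).subset fun _ hp => ⟨hp.head_mem, hp.tail_subset⟩).to_subtype

theorem segmentVal_isUpset : (segmentFrame Ax S hne).IsUpset (segmentVal hne) :=
  fun _ _ _ hle h => hle.1 h

theorem sat_segmentFrame (φ : Fml) (hφ : φ.sub ⊆ S) (w : (segmentFrame Ax S hne).W) :
    (segmentFrame Ax S hne).sat (segmentVal hne) φ w ↔ φ ∈ w.1.1 := by
  have hφS : φ ∈ S := hφ φ.mem_sub_self
  induction φ generalizing w with
  | var p => exact Iff.rfl
  | top =>
    obtain ⟨Γ, hΓ, hX⟩ := w.2.head_mem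
    rw [hX]
    exact iff_of_true trivial ⟨hΓ.closed (.ipc .top), hφS⟩
  | bot =>
    obtain ⟨Γ, hΓ, hX⟩ := w.2.head_mem
    rw [hX]
    exact iff_of_false id fun h => hΓ.bot_notMem h.1
  | and φ ψ ih₁ ih₂ =>
    have h₁ : φ.sub ⊆ S := fun _ h => hφ (.inr (.inl h))
    have h₂ : ψ.sub ⊆ S := fun _ h => hφ (.inr (.inr h))
    have hφ' := h₁ φ.mem_sub_self
    have hψ' := h₂ ψ.mem_sub_self
    obtain ⟨Γ, hΓ, hX⟩ := w.2.head_mem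
    refine (and_congr (ih₁ h₁ w hφ') (ih₂ h₂ w hψ')).trans ?_
    simp [hX, hΓ.and_mem, hφS, hφ', hψ']
  | or φ ψ ih₁ ih₂ =>
    have h₁ : φ.sub ⊆ S := fun _ h => hφ (.inr (.inl h))
    have h₂ : ψ.sub ⊆ S := fun _ h => hφ (.inr (.inr h))
    have hφ' := h₁ φ.mem_sub_self
    have hψ' := h₂ ψ.mem_sub_self
    obtain ⟨Γ, hΓ, hX⟩ := w.2.head_mem
    refine (or_congr (ih₁ h₁ w hφ') (ih₂ h₂ w hψ')).trans ?_
    simp [hX, hΓ.or_mem, hφS, hφ', hψ']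
  | imp φ ψ ih₁ ih₂ =>
    have h₁ : φ.sub ⊆ S := fun _ h => hφ (.inr (.inl h))
    have h₂ : ψ.sub ⊆ S := fun _ h => hφ (.inr (.inr h))
    have hφ' := h₁ φ.mem_sub_self
    have hψ' := h₂ ψ.mem_sub_self
    refine ⟨fun h => ?_, fun h v hle hv => ?_⟩
    · obtain ⟨Γ, hΓ, hX⟩ := w.2.head_mem
      by_contra hn
      have hd : ¬ Deriv Ax (insert φ Γ) ψ := fun hd =>
        hn (hX ▸ ⟨hΓ.closed hd.deduction, hφS⟩)
      obtain ⟨Δ, hΔ, hs, hψ⟩ := exists_primeTheory hd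
      let v : (segmentFrame Ax S hne).W := ⟨(Δ ∩ S, ∅), isSegment_empty ⟨Δ, hΔ, rfl⟩⟩
      have hle : TraceLE Ax w.1.1 (Δ ∩ S) :=
        hX ▸ hΓ.traceLE S hΔ ((Set.subset_insert _ _).trans hs)
      have hv := (ih₁ h₁ v hφ').2 ⟨hs (Set.mem_insert _ _), hφ'⟩
      exact hψ ((ih₂ h₂ v hψ').1 (h v hle hv)).1
    · have hv := (ih₁ h₁ v hφ').1 hv
      have h := hle.1 h
      refine (ih₂ h₂ v hψ').2 ?_
      obtain ⟨Δ, hΔ, hX⟩ := v.2.head_mem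
      rw [hX] at hv h ⊢
      exact ⟨hΔ.mp hv.1 h.1, hψ'⟩
  | sto φ ψ ih₁ ih₂ =>
    have h₁ : φ.sub ⊆ S := fun _ h => hφ (.inr (.inl h))
    have h₂ : ψ.sub ⊆ S := fun _ h => hφ (.inr (.inr h))
    have hφ' := h₁ φ.mem_sub_self
    have hψ' := h₂ ψ.mem_sub_self
    refine ⟨fun h => ?_, fun h w' hle hw' v hv => ?_⟩
    · obtain ⟨Γ, hΓ, hX⟩ := w.2.head_mem
      let w' : (segmentFrame Ax S hne).W := ⟨(Γ ∩ S, stoTail Ax S Γ φ), isSegment_stoTail hΓ φ⟩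
      have hle : TraceLE Ax w.1.1 (Γ ∩ S) := hX ▸ .refl _ _
      have hw' : ∀ v, (segmentFrame Ax S hne).R w' v →
          (segmentFrame Ax S hne).sat (segmentVal hne) φ v := by
        rintro v ⟨Δ, -, hs, hv⟩
        refine (ih₁ h₁ v hφ').2 ?_
        rw [hv]
        exact ⟨hs (hΓ.closed (.na .imp_self)), hφ'⟩
      rw [hX]
      refine ⟨sto_mem_of_stoTail (S := S) hΓ fun Y hY => ?_, hφS⟩
      let v : (segmentFrame Ax S hne).W :=
        ⟨(Y, ∅), isSegment_empty ((isSegment_stoTail hΓ φ).tail_subset hY)⟩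
      exact (ih₂ h₂ v hψ').1 (h w' hle hw' v hY)
    · refine (ih₂ h₂ v hψ').2 (w'.2.sto (hle.1 h) hψ' (fun Y hY => ?_) _ hv)
      let u : (segmentFrame Ax S hne).W := ⟨(Y, ∅), isSegment_empty (w'.2.tail_subset hY)⟩
      exact (ih₁ h₁ u hφ').1 (hw' u hY)

theorem segmentFrame_valid_em (hem : emFml ∈ Ax) : (segmentFrame Ax S hne).ValidFml emFml := by
  intro V hV w
  refine or_iff_not_imp_left.2 fun hn v hle hv => hn (hV 0 (w := v) ?_ hv)
  have h : w.1.1 = v.1.1 := hle.2 hem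
  exact ⟨h.ge, fun _ => h.symm⟩

theorem segmentFrame_valid_tb (htb : tbFml ∈ Ax) : (segmentFrame Ax S hne).ValidFml tbFml := by
  intro V _ _ v _ h
  obtain ⟨Γ, hΓ, hX⟩ := v.2.head_mem
  let v' : (segmentFrame Ax S hne).W := ⟨(Γ ∩ S, stoTail Ax S Γ .top), isSegment_stoTail hΓ .top⟩
  have hle : TraceLE Ax v.1.1 (Γ ∩ S) := hX ▸ .refl _ _
  refine h v' hle (fun _ _ => trivial) v ⟨Γ, hΓ, fun α hα => ?_, hX⟩
  exact hΓ.closed (.mp (.el hα) (.axm (fun _ => α) htb))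

theorem segmentFrame_valid_str (hstr : strFml ∈ Ax) :
    (segmentFrame Ax S hne).ValidFml strFml :=
  fun _ _ _ _ _ h w' hle hw' v hv =>
    h v ((segmentFrame Ax S hne).le_trans hle (w'.2.str hstr _ hv)) (hw' v hv)

end Segments

/-- for `Ax ⊆ {em, t□, str}`, the logic `HLC♭ ⊕ Ax` has the finite
model property: every finite consecution `Γ ⇒ φ` with `Γ ⊬_Ax φ` is refuted in a
finite flat model whose underlying frame validates every formula of `Ax`. -/
theorem fmp_em_tb_str (Ax : Set Fml) (hAx : Ax ⊆ {emFml, tbFml, strFml})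
    (Γ : Set Fml) (φ : Fml) (hfin : Γ.Finite) (h : ¬ Deriv Ax Γ φ) :
    ∃ (F : FlatFrame) (V : Nat → F.W → Prop), Finite F.W ∧ F.IsUpset V ∧
      (∀ ψ ∈ Ax, F.ValidFml ψ) ∧
      ∃ w : F.W, (∀ ψ ∈ Γ, F.sat V ψ w) ∧ ¬ F.sat V φ w := by
  obtain ⟨Δ, hΔ, hs, hφ⟩ := exists_primeTheory h
  let S : Set Fml := ⋃ ψ ∈ insert φ Γ, ψ.sub
  have hS : S.Finite := (hfin.insert φ).biUnion fun ψ _ => ψ.sub_finite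
  have hsub : ∀ ψ ∈ insert φ Γ, ψ.sub ⊆ S := fun ψ hψ => Set.subset_biUnion_of_mem hψ
  have hne : (traces Ax S).Nonempty := ⟨_, Δ, hΔ, rfl⟩
  refine ⟨segmentFrame Ax S hne, segmentVal hne, segmentFrame_finite hne hS,
    segmentVal_isUpset hne, fun ψ hψ => ?_, ⟨(Δ ∩ S, ∅), isSegment_empty ⟨Δ, hΔ, rfl⟩⟩,
    fun ψ hψ => ?_, fun hsat => ?_⟩
  · rcases hAx hψ with rfl | rfl | rfl
    · exact segmentFrame_valid_em hne hψ
    · exact segmentFrame_valid_tb hne hψ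
    · exact segmentFrame_valid_str hne hψ
  · have hψ' := hsub ψ (.inr hψ)
    exact (sat_segmentFrame hne ψ hψ' _).2 ⟨hs hψ, hψ' ψ.mem_sub_self⟩
  · exact hφ ((sat_segmentFrame hne φ (hsub φ (.inl rfl)) _).1 hsat).1
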